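/- arXiv:1609.05443 — 2 statements merged into one kernel-verified Lean document; each statement's English description precedes it below -/
import Mathlib

section
/- For every 0 < ν < 1 and every t > 0, the signaling Green function satisfies ∫₀^∞ r · G_s(r,t;ν) dr = 2ν t^{2ν−1}/Γ(1+2ν), the integral being convergent. -/
open Real MeasureTheory Set

/-- The Mainardi function `M_ν(x) = Σ_{n=0}^∞ (−x)^n/(n! · Γ(1 − ν − νn))`. -/
noncomputable def mainardi (ν x : ℝ) : ℝ :=
  ∑' n : ℕ, (-x) ^ n / ((n.factorial : ℝ) * Real.Gamma (1 - ν - ν * n))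

/-- The Green function of the signaling problem: `G_s(x,t;ν) = (ν x / t^{ν+1}) · M_ν(x/t^ν)`. -/
noncomputable def greenSignaling (ν x t : ℝ) : ℝ :=
  (ν * x / t ^ (ν + 1)) * mainardi ν (x / t ^ ν)

open Complex in
/-- The upper half of a Hankel contour in the logarithmic variable `w = log σ`: from `0` up to
`θ I`, then horizontally to `∞ + θ I`, parametrized by arc length. -/
noncomputable def hankelPath (θ τ : ℝ) : ℂ :=
  (max (τ - θ) 0 : ℝ) + (min τ θ : ℝ) * I

open Complex in
/-- The velocity of `hankelPath` times the exponential kernel `e^σ` at `σ = e^w`. -/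
noncomputable def hankelWeight (θ τ : ℝ) : ℂ :=
  (if τ ≤ θ then I else 1) * cexp (cexp (hankelPath θ τ))

/-- The integral of `exp (e^w + p w)` along `hankelPath`. -/
noncomputable def hankelIntegral (θ p : ℝ) : ℂ :=
  ∫ τ in Ioi (0 : ℝ), hankelWeight θ τ * Complex.exp (p * hankelPath θ τ)

lemma hankelPath_re (θ τ : ℝ) : (hankelPath θ τ).re = max (τ - θ) 0 := by
  simp [hankelPath]

lemma hankelPath_im (θ τ : ℝ) : (hankelPath θ τ).im = min τ θ := by
  simp [hankelPath]

lemma continuous_hankelPath (θ : ℝ) : Continuous (hankelPath θ) := by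
  unfold hankelPath
  fun_prop

lemma measurable_hankelWeight (θ : ℝ) : Measurable (hankelWeight θ) := by
  unfold hankelWeight
  refine (Measurable.ite measurableSet_Iic measurable_const measurable_const).mul ?_
  exact (Complex.continuous_exp.comp
    (Complex.continuous_exp.comp (continuous_hankelPath θ))).measurable

lemma norm_hankelWeight_le {θ τ : ℝ} :
    ‖hankelWeight θ τ‖ ≤
      Real.exp (1 - Real.cos θ) * Real.exp (-(-Real.cos θ * Real.exp (max (τ - θ) 0))) := by
  have h1 : ‖(if τ ≤ θ then Complex.I else 1 : ℂ)‖ = 1 := by split_ifs <;> simp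
  rw [hankelWeight, norm_mul, h1, one_mul, Complex.norm_exp, Complex.exp_re, hankelPath_re,
    hankelPath_im, ← Real.exp_add]
  apply Real.exp_le_exp.mpr
  rcases le_total τ θ with h | h
  · rw [max_eq_right (by linarith), min_eq_left h]
    have := Real.cos_le_one τ
    simp only [Real.exp_zero]
    linarith
  · rw [min_eq_right h]
    have := Real.cos_le_one θ
    nlinarith

lemma exp_mul_exp_neg_exp_le {c : ℝ} (hc : 0 < c) (p : ℝ) {u : ℝ} (hu : 0 ≤ u) :
    Real.exp (p * u) * Real.exp (-(c * Real.exp u)) ≤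
      Real.exp ((p + 1) ^ 2 / (2 * c)) * Real.exp (-u) := by
  rw [← Real.exp_add, ← Real.exp_add]
  apply Real.exp_le_exp.mpr
  have h1 := mul_le_mul_of_nonneg_left (Real.quadratic_le_exp_of_nonneg hu) hc.le
  have h2 : (p + 1) ^ 2 / (2 * c) + c * u ^ 2 / 2 - (p + 1) * u
      = (p + 1 - c * u) ^ 2 / (2 * c) := by
    field_simp
    ring
  have h3 : 0 ≤ (p + 1 - c * u) ^ 2 / (2 * c) := by positivity
  nlinarith [mul_nonneg hc.le hu]

lemma integrableOn_exp_mul_exp_neg_exp {c : ℝ} (hc : 0 < c) (p : ℝ) :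
    IntegrableOn (fun u : ℝ => Real.exp (p * u) * Real.exp (-(c * Real.exp u))) (Ioi 0) := by
  have h := (exp_neg_integrableOn_Ioi 0 one_pos).const_mul (Real.exp ((p + 1) ^ 2 / (2 * c)))
  refine Integrable.mono' h (by fun_prop) ?_
  filter_upwards [ae_restrict_mem measurableSet_Ioi] with u hu
  rw [Real.norm_of_nonneg (by positivity)]
  simpa using exp_mul_exp_neg_exp_le hc p (le_of_lt hu)

lemma integrableOn_exp_mul_exp_neg_exp_max {c : ℝ} (hc : 0 < c) (p θ : ℝ) :
    IntegrableOn (fun τ : ℝ => Real.exp (p * max (τ - θ) 0) *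
      Real.exp (-(c * Real.exp (max (τ - θ) 0)))) (Ioi 0) := by
  have h := (exp_neg_integrableOn_Ioi 0 one_pos).const_mul
    (Real.exp ((p + 1) ^ 2 / (2 * c)) * Real.exp θ)
  refine Integrable.mono' h (by fun_prop) ?_
  filter_upwards with τ
  rw [Real.norm_of_nonneg (by positivity)]
  refine (exp_mul_exp_neg_exp_le hc p (le_max_right _ _)).trans ?_
  rw [mul_assoc]
  refine mul_le_mul_of_nonneg_left ?_ (Real.exp_pos _).le
  rw [← Real.exp_add]
  exact Real.exp_le_exp.mpr (by linarith [le_max_left (τ - θ) 0])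

lemma norm_exp_mul_hankelPath (θ p τ : ℝ) :
    ‖Complex.exp (p * hankelPath θ τ)‖ = Real.exp (p * max (τ - θ) 0) := by
  simp [Complex.norm_exp, hankelPath_re]

lemma norm_hankelIntegrand_le (θ p τ : ℝ) :
    ‖hankelWeight θ τ * Complex.exp (p * hankelPath θ τ)‖ ≤
      Real.exp (1 - Real.cos θ) * (Real.exp (p * max (τ - θ) 0) *
        Real.exp (-(-Real.cos θ * Real.exp (max (τ - θ) 0)))) := by
  rw [norm_mul, norm_exp_mul_hankelPath]
  calc _ ≤ _ := mul_le_mul_of_nonneg_right (norm_hankelWeight_le (θ := θ) (τ := τ))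
        (Real.exp_pos _).le
    _ = _ := by ring

lemma measurable_hankelIntegrand (θ p : ℝ) :
    Measurable fun τ => hankelWeight θ τ * Complex.exp (p * hankelPath θ τ) := by
  have := (continuous_hankelPath θ).measurable
  have := measurable_hankelWeight θ
  fun_prop

lemma integrableOn_hankelIntegrand {θ : ℝ} (hθ : Real.cos θ < 0) (p : ℝ) :
    IntegrableOn (fun τ => hankelWeight θ τ * Complex.exp (p * hankelPath θ τ)) (Ioi 0) :=
  Integrable.mono' ((integrableOn_exp_mul_exp_neg_exp_max (neg_pos.mpr hθ) p θ).const_mul _)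
    (measurable_hankelIntegrand θ p).aestronglyMeasurable
    (Filter.Eventually.of_forall (norm_hankelIntegrand_le θ p))

lemma norm_exp_exp_add_mul (p a b : ℝ) :
    ‖Complex.exp (Complex.exp (a + b * Complex.I) + p * (a + b * Complex.I))‖ =
      Real.exp (p * a) * Real.exp (Real.cos b * Real.exp a) := by
  rw [Complex.norm_exp, ← Real.exp_add]
  simp [Complex.exp_re]
  ring

lemma integrableOn_exp_exp_horizontal {θ : ℝ} (hθ : Real.cos θ < 0) (p : ℝ) :
    IntegrableOn (fun a : ℝ => Complex.exp (Complex.exp (a + θ * Complex.I) +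
      p * (a + θ * Complex.I))) (Ioi 0) := by
  refine Integrable.mono' (integrableOn_exp_mul_exp_neg_exp (neg_pos.mpr hθ) p)
    (by fun_prop) (Filter.Eventually.of_forall fun a => ?_)
  rw [norm_exp_exp_add_mul]
  simp

lemma hankelIntegral_eq {θ : ℝ} (hθ0 : 0 ≤ θ) (hθ : Real.cos θ < 0) (p : ℝ) :
    hankelIntegral θ p =
      Complex.I * (∫ y in (0 : ℝ)..θ, Complex.exp (Complex.exp (y * Complex.I) +
        p * (y * Complex.I))) +
      ∫ a in Ioi (0 : ℝ), Complex.exp (Complex.exp (a + θ * Complex.I) +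
        p * (a + θ * Complex.I)) := by
  have hint := integrableOn_hankelIntegrand hθ p
  rw [hankelIntegral, ← Ioc_union_Ioi_eq_Ioi hθ0,
    setIntegral_union Ioc_disjoint_Ioi_same measurableSet_Ioi
      (hint.mono_set Ioc_subset_Ioi_self) (hint.mono_set (Ioi_subset_Ioi hθ0)),
    intervalIntegral.integral_of_le hθ0, ← integral_const_mul]
  congr 1
  · refine setIntegral_congr_fun measurableSet_Ioc fun y hy => ?_
    have h : hankelPath θ y = y * Complex.I := by
      simp [hankelPath, max_eq_right (sub_nonpos.mpr hy.2), min_eq_left hy.2]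
    simp only [hankelWeight, h, if_pos hy.2, Complex.exp_add]
    ring
  · have h := (measurePreserving_add_right volume θ).setIntegral_preimage_emb
      (measurableEmbedding_addRight θ)
      (fun τ => hankelWeight θ τ * Complex.exp (p * hankelPath θ τ)) (Ioi θ)
    rw [← h, preimage_add_const_Ioi, sub_self, Ioc_union_Ioi_eq_Ioi hθ0]
    refine setIntegral_congr_fun measurableSet_Ioi fun a ha => ?_
    have ha : 0 < a := ha
    have h : hankelPath θ (a + θ) = a + θ * Complex.I := by
      simp [hankelPath, ha.le]
    simp [hankelWeight, h, Complex.exp_add, ha]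

/-- The Hankel integral does not depend on the height of the contour. -/
lemma hankelIntegral_eq_pi {θ : ℝ} (hθ1 : π / 2 < θ) (hθ2 : θ ≤ π) (p : ℝ) :
    hankelIntegral θ p = hankelIntegral π p := by
  have hcos : Real.cos θ < 0 := Real.cos_neg_of_pi_div_two_lt_of_lt hθ1 (by linarith [pi_pos])
  have hcosπ : Real.cos π < 0 := by simp
  have hθ0 : 0 ≤ θ := by linarith [pi_pos]
  rw [hankelIntegral_eq hθ0 hcos, hankelIntegral_eq pi_pos.le hcosπ]
  set f : ℂ → ℂ := fun w => Complex.exp (Complex.exp w + p * w) with hf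
  have hfd : Differentiable ℂ f := by fun_prop
  have hfc : Continuous f := hfd.continuous
  have hrect (T : ℝ) := Complex.integral_boundary_rect_eq_zero_of_differentiableOn f
    (θ * Complex.I) (T + π * Complex.I) hfd.differentiableOn
  have hright : Filter.Tendsto (fun T : ℝ => ∫ y in θ..π, f (T + y * Complex.I))
      Filter.atTop (nhds 0) := by
    have hb : Filter.Tendsto (fun T : ℝ =>
        Real.exp ((p + 1) ^ 2 / (2 * (-Real.cos θ))) * Real.exp (-T) * |π - θ|)
        Filter.atTop (nhds 0) := by
      simpa using (Real.tendsto_exp_neg_atTop_nhds_zero.const_mul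
        (Real.exp ((p + 1) ^ 2 / (2 * (-Real.cos θ))))).mul_const |π - θ|
    refine squeeze_zero_norm' ?_ hb
    filter_upwards [Filter.eventually_ge_atTop 0] with T hT
    refine intervalIntegral.norm_integral_le_of_norm_le_const fun y hy => ?_
    rw [uIoc_of_le hθ2] at hy
    rw [hf, norm_exp_exp_add_mul]
    refine le_trans ?_ (exp_mul_exp_neg_exp_le (neg_pos.mpr hcos) p hT)
    gcongr
    rw [neg_mul, neg_neg]
    gcongr
    exact Real.cos_le_cos_of_nonneg_of_le_pi hθ0 hy.2 hy.1.le
  have hlim : Filter.Tendsto (fun T : ℝ => (∫ a in (0 : ℝ)..T, f (a + θ * Complex.I)) -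
      (∫ a in (0 : ℝ)..T, f (a + π * Complex.I)) +
      Complex.I * (∫ y in θ..π, f (T + y * Complex.I)) -
      Complex.I * (∫ y in θ..π, f (y * Complex.I))) Filter.atTop
      (nhds ((∫ a in Ioi (0 : ℝ), f (a + θ * Complex.I)) -
      (∫ a in Ioi (0 : ℝ), f (a + π * Complex.I)) + Complex.I * 0 -
      Complex.I * (∫ y in θ..π, f (y * Complex.I)))) :=
    (((intervalIntegral_tendsto_integral_Ioi 0 (integrableOn_exp_exp_horizontal hcos p)
      Filter.tendsto_id).sub (intervalIntegral_tendsto_integral_Ioi 0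
      (integrableOn_exp_exp_horizontal hcosπ p) Filter.tendsto_id)).add
      (hright.const_mul _)).sub_const _
  have hzero : (∫ a in Ioi (0 : ℝ), f (a + θ * Complex.I)) -
      (∫ a in Ioi (0 : ℝ), f (a + π * Complex.I)) + Complex.I * 0 -
      Complex.I * (∫ y in θ..π, f (y * Complex.I)) = 0 := by
    refine tendsto_nhds_unique hlim (tendsto_const_nhds.congr fun T => ?_)
    have := hrect T
    simp at this
    exact this.symm
  have hadd : (∫ y in (0 : ℝ)..θ, f (y * Complex.I)) + (∫ y in θ..π, f (y * Complex.I)) =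
      ∫ y in (0 : ℝ)..π, f (y * Complex.I) :=
    intervalIntegral.integral_add_adjacent_intervals
      ((by fun_prop : Continuous fun y : ℝ => f (y * Complex.I)).intervalIntegrable _ _)
      ((by fun_prop : Continuous fun y : ℝ => f (y * Complex.I)).intervalIntegrable _ _)
  change Complex.I * (∫ y in (0 : ℝ)..θ, f (y * Complex.I)) +
      (∫ a in Ioi (0 : ℝ), f (a + θ * Complex.I)) =
    Complex.I * (∫ y in (0 : ℝ)..π, f (y * Complex.I)) +
      (∫ a in Ioi (0 : ℝ), f (a + π * Complex.I))
  rw [← hadd]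
  linear_combination hzero

lemma integral_exp_mul_exp_neg_exp {p : ℝ} (hp : 0 < p) :
    Integrable (fun a : ℝ => Real.exp (p * a) * Real.exp (-Real.exp a)) ∧
    ∫ a : ℝ, Real.exp (p * a) * Real.exp (-Real.exp a) = Real.Gamma p := by
  have hg (a : ℝ) : |Real.exp a| • (Real.exp (-Real.exp a) * Real.exp a ^ (p - 1)) =
      Real.exp (p * a) * Real.exp (-Real.exp a) := by
    rw [abs_of_pos (Real.exp_pos a), ← Real.exp_mul, smul_eq_mul, ← Real.exp_add, ← Real.exp_add,
      ← Real.exp_add]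
    ring_nf
  have himg : Real.exp '' univ = Ioi 0 := by rw [image_univ, Real.range_exp]
  have hd : ∀ x ∈ (univ : Set ℝ), HasDerivWithinAt Real.exp (Real.exp x) univ x :=
    fun x _ => (Real.hasDerivAt_exp x).hasDerivWithinAt
  have hi := integrableOn_image_iff_integrableOn_abs_deriv_smul MeasurableSet.univ hd
    Real.exp_injective.injOn fun x => Real.exp (-x) * x ^ (p - 1)
  have he := integral_image_eq_integral_abs_deriv_smul MeasurableSet.univ hd
    Real.exp_injective.injOn fun x => Real.exp (-x) * x ^ (p - 1)
  simp only [himg, hg] at hi he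
  rw [integrableOn_univ] at hi
  rw [setIntegral_univ] at he
  exact ⟨hi.mp (Real.GammaIntegral_convergent hp), by rw [Real.Gamma_eq_integral hp, he]⟩

lemma hankelIntegral_pi_im_of_pos {p : ℝ} (hp : 0 < p) :
    (hankelIntegral π p).im = π / Real.Gamma (1 - p) := by
  rw [hankelIntegral_eq pi_pos.le (by simp)]
  set f : ℂ → ℂ := fun w => Complex.exp (Complex.exp w + p * w) with hf
  have hfd : Differentiable ℂ f := by fun_prop
  have hfc : Continuous f := hfd.continuous
  have hrect (R : ℝ) := Complex.integral_boundary_rect_eq_zero_of_differentiableOn f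
    (R : ℂ) (π * Complex.I) hfd.differentiableOn
  have hπ (a : ℝ) : f (a + π * Complex.I) =
      ((Real.exp (p * a) * Real.exp (-Real.exp a) : ℝ) : ℂ) *
        Complex.exp ((p * π : ℝ) * Complex.I) := by
    simp only [hf, Complex.ofReal_mul, Complex.ofReal_exp, ← Complex.exp_add, Complex.ofReal_neg,
      Complex.exp_add_pi_mul_I]
    congr 1
    ring
  have hreal (a : ℝ) : f a = (Real.exp (Real.exp a + p * a) : ℝ) := by
    simp [hf]
  obtain ⟨hint, hval⟩ := integral_exp_mul_exp_neg_exp hp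
  have hintC : Integrable fun a : ℝ => f (a + π * Complex.I) := by
    simp only [hπ]
    exact hint.ofReal.mul_const _
  have hleft : Filter.Tendsto (fun R : ℝ => ∫ y in (0 : ℝ)..π, f (R + y * Complex.I))
      Filter.atBot (nhds 0) := by
    have hb : Filter.Tendsto (fun R : ℝ => Real.exp (p * R) * Real.exp 1 * |π - 0|)
        Filter.atBot (nhds 0) := by
      simpa using ((Real.tendsto_exp_atBot.comp
        (Filter.tendsto_id.const_mul_atBot hp)).mul_const (Real.exp 1)).mul_const |π - 0|
    refine squeeze_zero_norm' ?_ hb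
    filter_upwards [Filter.eventually_le_atBot 0] with R hR
    refine intervalIntegral.norm_integral_le_of_norm_le_const fun y hy => ?_
    rw [hf, norm_exp_exp_add_mul]
    gcongr
    have := Real.exp_le_one_iff.mpr hR
    nlinarith [Real.exp_pos R, Real.cos_le_one y]
  have hlim : Filter.Tendsto (fun R : ℝ => (-(∫ a in R..(0 : ℝ), f (a + π * Complex.I)) +
      Complex.I * (∫ y in (0 : ℝ)..π, f (y * Complex.I)) -
      Complex.I * (∫ y in (0 : ℝ)..π, f (R + y * Complex.I))).im) Filter.atBot
      (nhds (-(∫ a in Iic (0 : ℝ), f (a + π * Complex.I)) +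
      Complex.I * (∫ y in (0 : ℝ)..π, f (y * Complex.I)) - Complex.I * 0).im) :=
    (Complex.continuous_im.tendsto _).comp
    (((intervalIntegral_tendsto_integral_Iic 0 hintC.integrableOn
      Filter.tendsto_id).neg.add_const _).sub (hleft.const_mul _))
  have hzero : (-(∫ a in Iic (0 : ℝ), f (a + π * Complex.I)) +
      Complex.I * (∫ y in (0 : ℝ)..π, f (y * Complex.I)) - Complex.I * 0).im = 0 := by
    refine tendsto_nhds_unique hlim (tendsto_const_nhds.congr fun R => ?_)
    have h := hrect R
    simp only [Complex.ofReal_re, Complex.ofReal_im, Complex.mul_re, Complex.mul_im, Complex.I_re,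
      Complex.I_im, mul_zero, mul_one, zero_mul, sub_zero, add_zero, Complex.ofReal_zero,
      hreal, zero_add, intervalIntegral.integral_ofReal, smul_eq_mul] at h
    have h2 := congrArg Complex.im h
    simp only [Complex.sub_im, Complex.add_im, Complex.ofReal_im, Complex.zero_im] at h2
    simp only [Complex.sub_im, Complex.add_im, Complex.neg_im]
    linarith
  have hsplit : (∫ a in Iic (0 : ℝ), f (a + π * Complex.I)) +
      (∫ a in Ioi (0 : ℝ), f (a + π * Complex.I)) = ∫ a : ℝ, f (a + π * Complex.I) :=
    intervalIntegral.integral_Iic_add_Ioi hintC.integrableOn hintC.integrableOn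
  have htotal : ∫ a : ℝ, f (a + π * Complex.I) =
      (Real.Gamma p : ℂ) * Complex.exp ((p * π : ℝ) * Complex.I) := by
    simp only [hπ]
    rw [integral_mul_const, integral_complex_ofReal, hval]
  have hrefl : Real.Gamma p * Real.sin (p * π) = π / Real.Gamma (1 - p) := by
    have h := Real.Gamma_mul_Gamma_one_sub p
    rcases eq_or_ne (Real.sin (π * p)) 0 with h0 | h0
    · rw [h0, div_zero, mul_eq_zero] at h
      rw [mul_comm p, h0, h.resolve_left (Real.Gamma_pos_of_pos hp).ne']
      simp
    · have h1 : Real.Gamma (1 - p) ≠ 0 := by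
        intro h1
        rw [h1, mul_zero] at h
        exact div_ne_zero pi_ne_zero h0 h.symm
      rw [mul_comm p, eq_div_iff h1, mul_right_comm, h, div_mul_cancel₀ _ h0]
  change (Complex.I * (∫ y in (0 : ℝ)..π, f (y * Complex.I)) +
      (∫ a in Ioi (0 : ℝ), f (a + π * Complex.I))).im = _
  rw [← hrefl]
  have h3 := congrArg Complex.im (hsplit.trans htotal)
  rw [Complex.im_ofReal_mul, Complex.exp_ofReal_mul_I_im, Complex.add_im] at h3
  simp only [Complex.sub_im, Complex.add_im, Complex.neg_im, mul_zero, Complex.zero_im] at hzero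
  rw [Complex.add_im]
  linarith

lemma tendsto_exp_exp_horizontal {θ : ℝ} (hθ : Real.cos θ < 0) (p : ℝ) :
    Filter.Tendsto (fun a : ℝ => Complex.exp (Complex.exp (a + θ * Complex.I) +
      p * (a + θ * Complex.I))) Filter.atTop (nhds 0) := by
  have hb : Filter.Tendsto (fun a : ℝ =>
      Real.exp ((p + 1) ^ 2 / (2 * (-Real.cos θ))) * Real.exp (-a)) Filter.atTop (nhds 0) := by
    simpa using Real.tendsto_exp_neg_atTop_nhds_zero.const_mul
      (Real.exp ((p + 1) ^ 2 / (2 * (-Real.cos θ))))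
  refine squeeze_zero_norm' ?_ hb
  filter_upwards [Filter.eventually_ge_atTop 0] with a ha
  rw [norm_exp_exp_add_mul]
  simpa using exp_mul_exp_neg_exp_le (neg_pos.mpr hθ) p ha

lemma hankelIntegral_add_one_im {θ : ℝ} (hθ0 : 0 ≤ θ) (hθ : Real.cos θ < 0) (p : ℝ) :
    (hankelIntegral θ (p + 1)).im = -p * (hankelIntegral θ p).im := by
  set f : ℂ → ℂ := fun w => Complex.exp (Complex.exp w + p * w) with hf
  set g : ℂ → ℂ := fun w => Complex.exp (Complex.exp w + (p + 1 : ℝ) * w) with hg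
  have hfd (w : ℂ) : HasDerivAt f (g w + p * f w) w := by
    have h := ((Complex.hasDerivAt_exp w).add ((hasDerivAt_id w).const_mul (p : ℂ))).cexp
    refine h.congr_deriv ?_
    simp only [hf, hg, Pi.add_apply, id, Complex.ofReal_add, Complex.ofReal_one, add_mul, one_mul,
      Complex.exp_add]
    ring
  have hfc : Continuous f := by fun_prop
  have hgc : Continuous g := by fun_prop
  have hvert : ∫ y in (0 : ℝ)..θ, (g (y * Complex.I) + p * f (y * Complex.I)) * Complex.I =
      f (θ * Complex.I) - f ((0 : ℝ) * Complex.I) := by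
    refine intervalIntegral.integral_eq_sub_of_hasDerivAt
      (f := fun y : ℝ => f (y * Complex.I)) (fun y _ => ?_)
      ((by fun_prop : Continuous fun y : ℝ => (g (y * Complex.I) + p * f (y * Complex.I)) *
        Complex.I).intervalIntegrable _ _)
    have h := (hasDerivAt_mul_const (x := (y : ℂ)) Complex.I)
    exact ((hfd _).comp (y : ℂ) h).comp_ofReal
  have hgi := integrableOn_exp_exp_horizontal hθ (p + 1)
  have hfi := integrableOn_exp_exp_horizontal hθ p
  have hhor : ∫ a in Ioi (0 : ℝ), (g (a + θ * Complex.I) + p * f (a + θ * Complex.I)) =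
      0 - f ((0 : ℝ) + θ * Complex.I) := by
    refine integral_Ioi_of_hasDerivAt_of_tendsto'
      (f := fun a : ℝ => f (a + θ * Complex.I)) (fun a _ => ?_)
      (hgi.add (hfi.const_mul _)) (tendsto_exp_exp_horizontal hθ p)
    have h := (hasDerivAt_id (a : ℂ)).add_const (θ * Complex.I)
    simpa using ((hfd _).comp (a : ℂ) h).comp_ofReal
  rw [intervalIntegral.integral_mul_const, intervalIntegral.integral_add
    ((by fun_prop : Continuous fun y : ℝ => g (y * Complex.I)).intervalIntegrable _ _)
    ((by fun_prop : Continuous fun y : ℝ => p * f (y * Complex.I)).intervalIntegrable _ _),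
    intervalIntegral.integral_const_mul] at hvert
  rw [integral_add hgi (hfi.const_mul _), integral_const_mul] at hhor
  have hsum : hankelIntegral θ (p + 1) + p * hankelIntegral θ p = -f 0 := by
    rw [hankelIntegral_eq hθ0 hθ, hankelIntegral_eq hθ0 hθ]
    simp only [Complex.ofReal_zero, zero_mul, zero_add] at hvert hhor
    linear_combination hvert + hhor
  have hf0 : (f 0).im = 0 := by
    have : f 0 = (Real.exp 1 : ℝ) := by simp [hf]
    rw [this, Complex.ofReal_im]
  have := congrArg Complex.im hsum
  rw [Complex.add_im, Complex.neg_im, hf0, Complex.im_ofReal_mul] at this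
  linarith

lemma continuousAt_hankelIntegral {θ : ℝ} (hθ : Real.cos θ < 0) (q : ℝ) :
    ContinuousAt (hankelIntegral θ) q := by
  refine tendsto_integral_filter_of_dominated_convergence
    (fun τ => Real.exp (1 - Real.cos θ) * (Real.exp ((q + 1) * max (τ - θ) 0) *
        Real.exp (-(-Real.cos θ * Real.exp (max (τ - θ) 0)))))
    (Filter.Eventually.of_forall fun p => (measurable_hankelIntegrand θ p).aestronglyMeasurable)
    ?_ ((integrableOn_exp_mul_exp_neg_exp_max (neg_pos.mpr hθ) (q + 1) θ).const_mul _)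
    (Filter.Eventually.of_forall fun τ => ?_)
  · filter_upwards [Iio_mem_nhds (lt_add_one q)] with p hp
    refine Filter.Eventually.of_forall fun τ => (norm_hankelIntegrand_le θ p τ).trans ?_
    have hp : p ≤ q + 1 := le_of_lt hp
    gcongr
  · exact (by fun_prop : Continuous fun p : ℝ =>
      hankelWeight θ τ * Complex.exp (p * hankelPath θ τ)).tendsto q

/-- The Hankel formula for the reciprocal Gamma function. -/
lemma hankelIntegral_im {θ : ℝ} (hθ1 : π / 2 < θ) (hθ2 : θ ≤ π) {p : ℝ} (hp : -2 < p) :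
    (hankelIntegral θ p).im = π / Real.Gamma (1 - p) := by
  have hcos : Real.cos θ < 0 := Real.cos_neg_of_pi_div_two_lt_of_lt hθ1 (by linarith [pi_pos])
  have hθ0 : 0 ≤ θ := by linarith [pi_pos]
  have hpos {p : ℝ} (hp : 0 < p) : (hankelIntegral θ p).im = π / Real.Gamma (1 - p) := by
    rw [hankelIntegral_eq_pi hθ1 hθ2, hankelIntegral_pi_im_of_pos hp]
  have hzero : (hankelIntegral θ 0).im = π / Real.Gamma (1 - 0) := by
    have h1 : Filter.Tendsto (fun p => (hankelIntegral θ p).im) (nhdsWithin 0 (Ioi 0))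
        (nhds (hankelIntegral θ 0).im) :=
      ((Complex.continuous_im.tendsto _).comp
        (continuousAt_hankelIntegral hcos 0)).mono_left nhdsWithin_le_nhds
    have h2 : ContinuousAt (fun p : ℝ => π / Real.Gamma (1 - p)) 0 := by
      have hΓ : ContinuousAt Real.Gamma (1 - 0) :=
        (Real.differentiableAt_Gamma fun m => by
          have : (0 : ℝ) ≤ m := m.cast_nonneg
          linarith).continuousAt
      have : ContinuousAt (fun p : ℝ => Real.Gamma (1 - p)) 0 :=
        ContinuousAt.comp (f := fun p : ℝ => 1 - p) hΓ (by fun_prop)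
      exact continuousAt_const.div this (by simp)
    refine tendsto_nhds_unique h1 ((h2.tendsto.mono_left nhdsWithin_le_nhds).congr' ?_)
    filter_upwards [self_mem_nhdsWithin] with p hp
    exact (hpos hp).symm
  have hstep {p : ℝ} (hp : p < 0)
      (h : (hankelIntegral θ (p + 1)).im = π / Real.Gamma (1 - (p + 1))) :
      (hankelIntegral θ p).im = π / Real.Gamma (1 - p) := by
    rw [hankelIntegral_add_one_im hθ0 hcos] at h
    have hΓ : Real.Gamma (1 - p) = -p * Real.Gamma (-p) := by
      rw [← Real.Gamma_add_one (by linarith : -p ≠ 0)]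
      ring_nf
    have hne : Real.Gamma (-p) ≠ 0 := (Real.Gamma_pos_of_pos (by linarith)).ne'
    rw [show 1 - (p + 1) = -p by ring] at h
    rw [hΓ, div_mul_eq_div_div_swap, ← h, mul_div_cancel_left₀ _ (by linarith)]
  have hnonneg {p : ℝ} (hp : 0 ≤ p) : (hankelIntegral θ p).im = π / Real.Gamma (1 - p) := by
    rcases hp.eq_or_lt with rfl | hp
    · exact hzero
    · exact hpos hp
  have hgt {p : ℝ} (hp : -1 ≤ p) : (hankelIntegral θ p).im = π / Real.Gamma (1 - p) := by
    rcases le_or_gt 0 p with h | h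
    · exact hnonneg h
    · exact hstep h (hnonneg (by linarith))
  rcases le_or_gt (-1) p with h | h
  · exact hgt h
  · exact hstep (by linarith) (hgt (by linarith))

lemma exists_mul_exp_le_add {ν c x : ℝ} (hν0 : 0 ≤ ν) (hν1 : ν < 1) (hc : 0 < c) (hx : 0 < x) :
    ∃ K, ∀ u : ℝ, x * Real.exp (ν * u) ≤ c * Real.exp u + K := by
  set u₀ := Real.log (x / c) / (1 - ν) with hu₀
  have h1ν : 0 < 1 - ν := by linarith
  refine ⟨x * Real.exp (ν * u₀), fun u => ?_⟩
  rcases le_total u u₀ with h | h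
  · have : x * Real.exp (ν * u) ≤ x * Real.exp (ν * u₀) := by gcongr
    linarith [mul_pos hc (Real.exp_pos u)]
  · have h1 : x / c ≤ Real.exp ((1 - ν) * u) := by
      rw [← Real.log_le_iff_le_exp (by positivity), mul_comm, ← div_le_iff₀ h1ν]
      exact h
    have h2 : x ≤ c * Real.exp ((1 - ν) * u) := by
      rwa [div_le_iff₀' hc] at h1
    have h3 : x * Real.exp (ν * u) ≤ c * Real.exp u := by
      calc x * Real.exp (ν * u) ≤ c * Real.exp ((1 - ν) * u) * Real.exp (ν * u) := by gcongr
        _ = c * Real.exp u := by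
          rw [mul_assoc, ← Real.exp_add]
          ring_nf
    linarith [mul_pos hx (Real.exp_pos (ν * u₀))]

/-- The integrand of the contour integral representation of the Mainardi function. -/
noncomputable def mainardiIntegrand (θ ν x τ : ℝ) : ℂ :=
  hankelWeight θ τ * Complex.exp (ν * hankelPath θ τ) *
    Complex.exp (-x * Complex.exp (ν * hankelPath θ τ))

lemma mainardi_eq_contour_integral {θ ν x : ℝ} (hθ1 : π / 2 < θ) (hθ2 : θ ≤ π) (hν0 : 0 < ν)
    (hν1 : ν < 1) (hx : 0 < x) :
    mainardi ν x = (∫ τ in Ioi (0 : ℝ), mainardiIntegrand θ ν x τ).im / π := by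
  have hcos : Real.cos θ < 0 := Real.cos_neg_of_pi_div_two_lt_of_lt hθ1 (by linarith [pi_pos])
  set c := -Real.cos θ / 2 with hc
  have hc0 : 0 < c := by linarith
  obtain ⟨K, hK⟩ := exists_mul_exp_le_add hν0.le hν1 hc0 hx
  set F : ℕ → ℝ → ℂ := fun n τ => ((-x) ^ n / n.factorial : ℝ) *
    (hankelWeight θ τ * Complex.exp ((ν + ν * n : ℝ) * hankelPath θ τ)) with hF
  have hFeq (n : ℕ) (τ : ℝ) : F n τ = hankelWeight θ τ * Complex.exp (ν * hankelPath θ τ) *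
      ((-x * Complex.exp (ν * hankelPath θ τ)) ^ n / n.factorial) := by
    simp only [hF, mul_pow, ← Complex.exp_nat_mul]
    push_cast
    rw [show ((ν : ℂ) + ν * n) * hankelPath θ τ =
      ν * hankelPath θ τ + n * (ν * hankelPath θ τ) by ring, Complex.exp_add]
    ring
  have hexpSum (z : ℂ) : HasSum (fun n : ℕ => z ^ n / n.factorial) (Complex.exp z) := by
    rw [Complex.exp_eq_exp_ℂ]
    exact NormedSpace.expSeries_div_hasSum_exp z
  have hexpSumReal (z : ℝ) : HasSum (fun n : ℕ => z ^ n / n.factorial) (Real.exp z) := by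
    rw [Real.exp_eq_exp_ℝ]
    exact NormedSpace.expSeries_div_hasSum_exp z
  set b : ℝ → ℝ := fun τ => Real.exp (1 - Real.cos θ) * (Real.exp (ν * max (τ - θ) 0) *
        Real.exp (-(-Real.cos θ * Real.exp (max (τ - θ) 0)))) with hb
  have hnorm (n : ℕ) (τ : ℝ) :
      ‖F n τ‖ ≤ b τ * ((x * Real.exp (ν * max (τ - θ) 0)) ^ n / n.factorial) := by
    rw [hFeq, norm_mul]
    refine mul_le_mul (norm_hankelIntegrand_le θ ν τ) (le_of_eq ?_) (norm_nonneg _)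
      (by positivity)
    simp [norm_exp_mul_hankelPath, abs_of_pos hx]
  have hbsum (τ : ℝ) : HasSum
      (fun n : ℕ => b τ * ((x * Real.exp (ν * max (τ - θ) 0)) ^ n / n.factorial))
      (b τ * Real.exp (x * Real.exp (ν * max (τ - θ) 0))) :=
    (hexpSumReal _).mul_left _
  have hbint : IntegrableOn (fun τ => b τ * Real.exp (x * Real.exp (ν * max (τ - θ) 0)))
      (Ioi 0) := by
    refine Integrable.mono' ((integrableOn_exp_mul_exp_neg_exp_max hc0 ν θ).const_mul
      (Real.exp (1 - Real.cos θ) * Real.exp K)) (by fun_prop)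
      (Filter.Eventually.of_forall fun τ => ?_)
    rw [Real.norm_of_nonneg (by positivity)]
    have hcθ : -Real.cos θ = 2 * c := by rw [hc]; ring
    simp only [hb, ← Real.exp_add, hcθ]
    apply Real.exp_le_exp.mpr
    linarith [hK (max (τ - θ) 0)]
  have hsum := hasSum_integral_of_dominated_convergence (μ := volume.restrict (Ioi 0))
    (F := F) (f := mainardiIntegrand θ ν x)
    (fun n τ => b τ * ((x * Real.exp (ν * max (τ - θ) 0)) ^ n / n.factorial))
    (fun n => ((measurable_hankelIntegrand θ (ν + ν * n)).const_mul _).aestronglyMeasurable)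
    (fun n => Filter.Eventually.of_forall (hnorm n))
    (Filter.Eventually.of_forall fun τ => (hbsum τ).summable)
    (by simp only [(hbsum _).tsum_eq]; exact hbint)
    (Filter.Eventually.of_forall fun τ => by
      simp only [hFeq]
      exact (hexpSum _).mul_left _)
  have him := (Complex.hasSum_im hsum).div_const π
  rw [← him.tsum_eq, mainardi]
  refine tsum_congr fun n => ?_
  have hp : -2 < ν + ν * n := by
    have : 0 ≤ ν * n := by positivity
    linarith
  have hI : ∫ τ in Ioi (0 : ℝ), F n τ = ((-x) ^ n / n.factorial : ℝ) *
      hankelIntegral θ (ν + ν * n) := by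
    rw [hankelIntegral, ← integral_const_mul]
  rw [hI, Complex.im_ofReal_mul, hankelIntegral_im hθ1 hθ2 hp, sub_sub]
  rw [div_mul_div_comm, div_div, mul_div_mul_right _ _ pi_ne_zero]

lemma integral_sq_mul_exp_neg_mul {z : ℂ} (hz : 0 < z.re) :
    ∫ x in Ioi (0 : ℝ), (x : ℂ) ^ 2 * Complex.exp (-x * z) = 2 / z ^ 3 := by
  have hz0 : z ≠ 0 := by
    rintro rfl
    simp at hz
  set A : ℂ → ℂ := fun x => -(x ^ 2 / z + 2 * x / z ^ 2 + 2 / z ^ 3) * Complex.exp (-x * z)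
  have hderiv (x : ℂ) : HasDerivAt A (x ^ 2 * Complex.exp (-x * z)) x := by
    have h1 : HasDerivAt (fun x : ℂ => Complex.exp (-x * z)) (Complex.exp (-x * z) * (-1 * z)) x :=
      (((hasDerivAt_id x).neg).mul_const z).cexp
    have h2 : HasDerivAt (fun x : ℂ => -(x ^ 2 / z + 2 * x / z ^ 2 + 2 / z ^ 3))
        (-(2 * x / z + 2 / z ^ 2)) x := by
      have h3 := (((hasDerivAt_pow 2 x).div_const z).add
        (((hasDerivAt_id x).const_mul 2).div_const (z ^ 2))).add_const (2 / z ^ 3)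
      refine h3.neg.congr_deriv ?_
      simp
    refine (h2.mul h1).congr_deriv ?_
    field_simp
    ring
  have hnorm (x : ℝ) : ‖Complex.exp (-x * z)‖ = Real.exp (-z.re * x) := by
    simp [Complex.norm_exp, mul_comm]
  have hpow (n : ℕ) : Filter.Tendsto (fun x : ℝ => (x : ℂ) ^ n * Complex.exp (-x * z))
      Filter.atTop (nhds 0) := by
    rw [tendsto_zero_iff_norm_tendsto_zero]
    refine (tendsto_rpow_mul_exp_neg_mul_atTop_nhds_zero n z.re hz).congr' ?_
    filter_upwards [Filter.eventually_ge_atTop 0] with x hx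
    rw [norm_mul, hnorm, norm_pow, Complex.norm_real, Real.norm_of_nonneg hx, Real.rpow_natCast]
  have hlim : Filter.Tendsto (fun x : ℝ => A x) Filter.atTop (nhds 0) := by
    have h := (((hpow 2).const_mul (-1 / z)).add ((hpow 1).const_mul (-2 / z ^ 2))).add
      ((hpow 0).const_mul (-2 / z ^ 3))
    simp only [mul_zero, add_zero] at h
    refine h.congr fun x => ?_
    simp only [A]
    ring
  have hint : IntegrableOn (fun x : ℝ => (x : ℂ) ^ 2 * Complex.exp (-x * z)) (Ioi 0) := by
    have h := integrableOn_rpow_mul_exp_neg_mul_rpow (p := 1) (s := 2) (by norm_num) one_pos hz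
    refine Integrable.mono' h (by fun_prop) (Filter.Eventually.of_forall fun x => ?_)
    rw [norm_mul, hnorm, norm_pow, Complex.norm_real]
    simp
  rw [integral_Ioi_of_hasDerivAt_of_tendsto' (f := fun x : ℝ => A x)
    (fun x _ => (hderiv x).comp_ofReal) hint hlim]
  simp [A]

lemma le_re_exp_mul_hankelPath {θ ν τ : ℝ} (hν : 0 ≤ ν) (hθ : 0 ≤ θ) (hνθ : ν * θ < π / 2)
    (hτ : 0 ≤ τ) : Real.cos (ν * θ) ≤ (Complex.exp (ν * hankelPath θ τ)).re := by
  have hre : (Complex.exp (ν * hankelPath θ τ)).re =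
      Real.exp (ν * max (τ - θ) 0) * Real.cos (ν * min τ θ) := by
    simp [Complex.exp_re, hankelPath_re, hankelPath_im]
  have h1 : Real.cos (ν * θ) ≤ Real.cos (ν * min τ θ) :=
    Real.cos_le_cos_of_nonneg_of_le_pi (by positivity) (by linarith [pi_pos])
      (mul_le_mul_of_nonneg_left (min_le_right _ _) hν)
  have h2 : 1 ≤ Real.exp (ν * max (τ - θ) 0) := Real.one_le_exp (by positivity)
  have h3 : 0 < Real.cos (ν * θ) := Real.cos_pos_of_mem_Ioo
    ⟨by linarith [mul_nonneg hν hθ, pi_pos], hνθ⟩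
  rw [hre]
  nlinarith

lemma integrable_sq_mul_mainardiIntegrand {θ ν : ℝ} (hν : 0 ≤ ν) (hθ0 : 0 ≤ θ)
    (hθ : Real.cos θ < 0) (hνθ : ν * θ < π / 2) :
    Integrable (Function.uncurry fun x τ : ℝ => (x : ℂ) ^ 2 * mainardiIntegrand θ ν x τ)
      ((volume.restrict (Ioi 0)).prod (volume.restrict (Ioi 0))) := by
  have hd : 0 < Real.cos (ν * θ) := Real.cos_pos_of_mem_Ioo
    ⟨by linarith [mul_nonneg hν hθ0, pi_pos], hνθ⟩
  have hx := integrableOn_rpow_mul_exp_neg_mul_rpow (p := 1) (s := 2) (by norm_num) one_pos hd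
  have hτ := (integrableOn_exp_mul_exp_neg_exp_max (neg_pos.mpr hθ) ν θ).const_mul
    (Real.exp (1 - Real.cos θ))
  refine Integrable.mono' (hx.mul_prod hτ) ?_ ?_
  · have hpath : Measurable fun z : ℝ × ℝ => hankelPath θ z.2 :=
      (continuous_hankelPath θ).measurable.comp measurable_snd
    have hweight : Measurable fun z : ℝ × ℝ => hankelWeight θ z.2 :=
      (measurable_hankelWeight θ).comp measurable_snd
    refine Measurable.aestronglyMeasurable ?_
    unfold Function.uncurry mainardiIntegrand
    fun_prop
  · rw [Measure.prod_restrict]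
    filter_upwards [ae_restrict_mem (measurableSet_Ioi.prod measurableSet_Ioi)] with z hz
    obtain ⟨hz1 : 0 < z.1, hz2 : 0 < z.2⟩ := hz
    have hexp : ‖Complex.exp (-z.1 * Complex.exp (ν * hankelPath θ z.2))‖ ≤
        Real.exp (-Real.cos (ν * θ) * z.1) := by
      rw [Complex.norm_exp]
      apply Real.exp_le_exp.mpr
      have h := mul_le_mul_of_nonneg_left
        (le_re_exp_mul_hankelPath hν hθ0 hνθ hz2.le) hz1.le
      rw [← Complex.ofReal_neg, Complex.re_ofReal_mul]
      linarith
    simp only [Function.uncurry, mainardiIntegrand, Real.rpow_one, Real.rpow_two]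
    rw [norm_mul, norm_mul, norm_pow, Complex.norm_real, Real.norm_eq_abs, sq_abs]
    calc _ ≤ z.1 ^ 2 * (_ * Real.exp (-Real.cos (ν * θ) * z.1)) :=
          mul_le_mul_of_nonneg_left (mul_le_mul (norm_hankelIntegrand_le θ ν z.2) hexp
            (norm_nonneg _) (by positivity)) (sq_nonneg _)
      _ = _ := by ring

lemma mainardi_second_moment {ν : ℝ} (hν0 : 0 < ν) (hν1 : ν < 1) :
    IntegrableOn (fun x : ℝ => x ^ 2 * mainardi ν x) (Ioi 0) ∧
    ∫ x in Ioi (0 : ℝ), x ^ 2 * mainardi ν x = 2 / Real.Gamma (1 + 2 * ν) := by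
  set θ := π / (1 + ν) with hθ
  have hθ1 : π / 2 < θ := by
    rw [hθ]
    gcongr
    linarith
  have hθ2 : θ ≤ π := div_le_self pi_pos.le (by linarith)
  have hθ0 : 0 ≤ θ := by linarith [pi_pos]
  have hνθ : ν * θ < π / 2 := by
    have : ν * θ = π - θ := by
      rw [hθ]
      field_simp
      ring
    linarith
  have hcos : Real.cos θ < 0 := Real.cos_neg_of_pi_div_two_lt_of_lt hθ1 (by linarith [pi_pos])
  have hint := integrable_sq_mul_mainardiIntegrand hν0.le hθ0 hcos hνθ
  have hrepr : EqOn (fun x : ℝ => x ^ 2 * mainardi ν x) (fun x =>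
      (∫ τ in Ioi (0 : ℝ), (x : ℂ) ^ 2 * mainardiIntegrand θ ν x τ).im / π) (Ioi 0) := by
    intro x hx
    simp only [integral_const_mul, mainardi_eq_contour_integral hθ1 hθ2 hν0 hν1 hx]
    rw [← Complex.ofReal_pow, Complex.im_ofReal_mul, mul_div_assoc]
  have hleft := hint.integral_prod_left
  simp only [Function.uncurry] at hleft
  refine ⟨(integrableOn_congr_fun hrepr measurableSet_Ioi).mpr (hleft.im.div_const π), ?_⟩
  have hinner : ∀ τ ∈ Ioi (0 : ℝ), ∫ x in Ioi (0 : ℝ), (x : ℂ) ^ 2 * mainardiIntegrand θ ν x τ =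
      2 * (hankelWeight θ τ * Complex.exp ((-(2 * ν) : ℝ) * hankelPath θ τ)) := by
    intro τ hτ
    have hd : 0 < Real.cos (ν * θ) := Real.cos_pos_of_mem_Ioo
      ⟨by linarith [mul_nonneg hν0.le hθ0, pi_pos], hνθ⟩
    have hz := hd.trans_le (le_re_exp_mul_hankelPath hν0.le hθ0 hνθ (le_of_lt hτ))
    have h := integral_sq_mul_exp_neg_mul hz
    have hre (x : ℝ) : (x : ℂ) ^ 2 * mainardiIntegrand θ ν x τ =
        hankelWeight θ τ * Complex.exp (ν * hankelPath θ τ) *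
          ((x : ℂ) ^ 2 * Complex.exp (-x * Complex.exp (ν * hankelPath θ τ))) := by
      rw [mainardiIntegrand]
      ring
    simp only [hre]
    rw [integral_const_mul, h, ← Complex.exp_nat_mul, div_eq_mul_inv, ← Complex.exp_neg]
    have he : Complex.exp (ν * hankelPath θ τ) * Complex.exp (-((3 : ℕ) * (ν * hankelPath θ τ))) =
        Complex.exp ((-(2 * ν) : ℝ) * hankelPath θ τ) := by
      rw [← Complex.exp_add]
      congr 1
      push_cast
      ring
    rw [← he]
    ring
  have him := integral_im hleft
  simp only [RCLike.im_to_complex] at him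
  rw [setIntegral_congr_fun measurableSet_Ioi hrepr, integral_div, him,
    integral_integral_swap hint, setIntegral_congr_fun measurableSet_Ioi hinner,
    integral_const_mul]
  change (2 * hankelIntegral θ (-(2 * ν))).im / π = _
  rw [← Complex.ofReal_ofNat, Complex.im_ofReal_mul, hankelIntegral_im hθ1 hθ2 (by linarith),
    sub_neg_eq_add, ← mul_div_assoc, div_right_comm, mul_div_cancel_right₀ _ pi_ne_zero]

theorem greenSignaling_space_first_moment (ν : ℝ) (hν0 : 0 < ν) (hν1 : ν < 1)
    (t : ℝ) (ht : 0 < t) :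
    IntegrableOn (fun r : ℝ => r * greenSignaling ν r t) (Ioi 0) ∧
    ∫ r in Ioi (0 : ℝ), r * greenSignaling ν r t =
      2 * ν * t ^ (2 * ν - 1) / Real.Gamma (1 + 2 * ν) := by
  obtain ⟨hint, hval⟩ := mainardi_second_moment hν0 hν1
  have hb : 0 < (t ^ ν)⁻¹ := by positivity
  have hscale (r : ℝ) : r * greenSignaling ν r t = ν * t ^ (ν - 1) *
      (((t ^ ν)⁻¹ * r) ^ 2 * mainardi ν ((t ^ ν)⁻¹ * r)) := by
    rw [greenSignaling, Real.rpow_add_one ht.ne', Real.rpow_sub_one ht.ne', div_eq_inv_mul r]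
    field_simp
  simp only [hscale]
  constructor
  · refine Integrable.const_mul ?_ _
    have h := (integrableOn_Ioi_comp_mul_left_iff
      (fun x => x ^ 2 * mainardi ν x) 0 hb).mpr (by simpa using hint)
    exact h
  · rw [integral_const_mul, integral_comp_mul_left_Ioi (fun x => x ^ 2 * mainardi ν x) 0 hb,
      mul_zero, hval, inv_inv, smul_eq_mul, show 2 * ν - 1 = (ν - 1) + ν by ring,
      Real.rpow_add ht]
    ring
end

section
/- For every 0 < ν < 1 and every t > 0, the center of gravity in space of the signaling Green function satisfies (∫₀^∞ r · G_s(r,t;ν) dr)/(∫₀^∞ G_s(r,t;ν) dr) = (Γ(ν)/Γ(2ν)) · t^ν = (√π · 2^{1−2ν}/Γ(ν + 1/2)) · t^ν. -/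
open Real MeasureTheory Set

/-- Two holomorphic functions on a connected open set that agree near a point of the real line
are equal. -/
theorem eqOn_of_eventuallyEq_ofReal {U : Set ℂ} (hU : IsOpen U) (hUc : IsPreconnected U)
    {f g : ℂ → ℂ} (hf : DifferentiableOn ℂ f U) (hg : DifferentiableOn ℂ g U) {x₀ : ℝ}
    (hx₀ : (x₀ : ℂ) ∈ U) (h : ∀ᶠ x : ℝ in nhds x₀, f x = g x) : EqOn f g U := by
  refine (hf.analyticOnNhd hU).eqOn_of_preconnected_of_frequently_eq (hg.analyticOnNhd hU) hUc
    hx₀ ?_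
  have ht : Filter.Tendsto (fun x : ℝ => (x : ℂ)) (nhdsWithin x₀ {x₀}ᶜ)
      (nhdsWithin (x₀ : ℂ) {(x₀ : ℂ)}ᶜ) :=
    tendsto_nhdsWithin_iff.2 ⟨(Complex.continuous_ofReal.tendsto x₀).mono_left nhdsWithin_le_nhds,
      by filter_upwards [self_mem_nhdsWithin] with x hx using by simpa using hx⟩
  exact ht.frequently (h.filter_mono nhdsWithin_le_nhds).frequently

theorem norm_cexp_neg_mul_ofReal (z : ℂ) (y : ℝ) :
    ‖Complex.exp (-(z * y))‖ = rexp (-(z.re * y)) := by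
  simp [Complex.norm_exp]

theorem integrableOn_rpow_mul_exp_neg_mul {a c : ℝ} (ha : 0 < a) (hc : 0 < c) :
    IntegrableOn (fun v : ℝ => v ^ (a - 1) * rexp (-(c * v))) (Ioi 0) := by
  simpa using integrableOn_rpow_mul_exp_neg_mul_rpow (s := a - 1) (by linarith) one_pos hc

theorem integrableOn_rpow_mul_cexp_neg_mul {a : ℝ} (ha : 0 < a) {z : ℂ} (hz : 0 < z.re) :
    IntegrableOn (fun v : ℝ => ((v ^ (a - 1) : ℝ) : ℂ) * Complex.exp (-(z * v))) (Ioi 0) := by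
  refine (integrableOn_rpow_mul_exp_neg_mul ha hz).mono' (by fun_prop) ?_
  filter_upwards [ae_restrict_mem measurableSet_Ioi] with v hv
  rw [norm_mul, norm_cexp_neg_mul_ofReal, Complex.norm_real,
    Real.norm_of_nonneg (rpow_nonneg (le_of_lt hv) _)]

theorem differentiableOn_integral_rpow_mul_cexp_neg_mul {a : ℝ} (ha : 0 < a) :
    DifferentiableOn ℂ (fun z : ℂ => ∫ v in Ioi (0 : ℝ),
      ((v ^ (a - 1) : ℝ) : ℂ) * Complex.exp (-(z * v))) {z | 0 < z.re} := by
  intro z hz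
  change 0 < z.re at hz
  have hs : {w : ℂ | z.re / 2 < w.re} ∈ nhds z :=
    (isOpen_lt continuous_const Complex.continuous_re).mem_nhds (by simp; linarith)
  refine (hasDerivAt_integral_of_dominated_loc_of_deriv_le (μ := volume.restrict (Ioi 0))
    (F := fun w (v : ℝ) => ((v ^ (a - 1) : ℝ) : ℂ) * Complex.exp (-(w * v)))
    (F' := fun w (v : ℝ) => ((v ^ (a - 1) : ℝ) : ℂ) * (Complex.exp (-(w * v)) * -v))
    (bound := fun v : ℝ => v ^ (a + 1 - 1) * rexp (-(z.re / 2 * v))) hs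
    (Filter.Eventually.of_forall fun w => by fun_prop)
    (integrableOn_rpow_mul_cexp_neg_mul ha hz) (by fun_prop) ?_
    (integrableOn_rpow_mul_exp_neg_mul (by linarith) (by linarith)) ?_).2
    |>.differentiableAt.differentiableWithinAt
  · filter_upwards [ae_restrict_mem measurableSet_Ioi] with v hv w hw
    simp only [mem_Ioi] at hv
    change z.re / 2 < w.re at hw
    have hva : v ^ (a + 1 - 1) = v ^ (a - 1) * v := by
      rw [← rpow_add_one hv.ne']
      ring_nf
    rw [norm_mul, norm_mul, norm_cexp_neg_mul_ofReal, norm_neg, Complex.norm_real,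
      Complex.norm_real, Real.norm_of_nonneg hv.le, Real.norm_of_nonneg (rpow_nonneg hv.le _),
      hva, mul_right_comm, ← mul_assoc]
    gcongr
  · refine Filter.Eventually.of_forall fun v w _ => ?_
    have h : HasDerivAt (fun w : ℂ => -(w * (v : ℂ))) (-v) w := by
      simpa using ((hasDerivAt_id' w).mul_const (v : ℂ)).fun_neg
    exact h.cexp.const_mul _

/-- The Laplace integral `∫ v^(a-1) e^(-z v) dv` for a complex rate `z` in the right half-plane. -/
theorem integral_rpow_mul_cexp_neg_mul {a : ℝ} (ha : 0 < a) {z : ℂ} (hz : 0 < z.re) :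
    ∫ v in Ioi (0 : ℝ), ((v ^ (a - 1) : ℝ) : ℂ) * Complex.exp (-(z * v)) =
      (1 / z) ^ (a : ℂ) * (Real.Gamma a : ℂ) := by
  refine eqOn_of_eventuallyEq_ofReal (U := {z : ℂ | 0 < z.re}) (x₀ := 1)
    (g := fun z => (1 / z) ^ (a : ℂ) * (Real.Gamma a : ℂ))
    (isOpen_lt continuous_const Complex.continuous_re)
    (convex_halfSpace_re_gt 0).isPreconnected
    (differentiableOn_integral_rpow_mul_cexp_neg_mul ha) ?_ (by simp) ?_ hz
  · intro w hw
    change 0 < w.re at hw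
    have hw0 : w ≠ 0 := fun h => by simp [h] at hw
    refine DifferentiableAt.differentiableWithinAt ?_
    refine (DifferentiableAt.cpow_const ?_ (Or.inl ?_)).mul_const _
    · fun_prop (disch := assumption)
    · rw [one_div, Complex.inv_re]
      exact div_pos hw (Complex.normSq_pos.2 hw0)
  · filter_upwards [eventually_gt_nhds one_pos] with r hr
    rw [← Complex.Gamma_ofReal,
      ← Complex.integral_cpow_mul_exp_neg_mul_Ioi (a := (a : ℂ)) (by simpa using ha) hr]
    refine setIntegral_congr_fun measurableSet_Ioi fun v hv => ?_
    simp only [mem_Ioi] at hv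
    simp [Complex.ofReal_cpow hv.le]

theorem integral_rpow_mul_cexp_neg_mul_rpow {a p : ℝ} (ha : 0 < a) (hp : 0 < p) {z : ℂ}
    (hz : 0 < z.re) :
    ∫ v in Ioi (0 : ℝ), ((v ^ (a - 1) : ℝ) : ℂ) * Complex.exp (-(z * (v ^ p : ℝ))) =
      (1 / p) * ((1 / z) ^ ((a / p : ℝ) : ℂ) * (Real.Gamma (a / p) : ℂ)) := by
  rw [← integral_rpow_mul_cexp_neg_mul (div_pos ha hp) hz,
    ← integral_comp_rpow_Ioi_of_pos (g := fun v : ℝ =>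
      ((v ^ (a / p - 1) : ℝ) : ℂ) * Complex.exp (-(z * v))) hp, ← integral_const_mul]
  refine setIntegral_congr_fun measurableSet_Ioi fun v hv => ?_
  simp only [mem_Ioi] at hv
  have hexp : v ^ (p - 1) * (v ^ p) ^ (a / p - 1) = v ^ (a - 1) := by
    rw [← rpow_mul hv.le, ← rpow_add hv]
    congr 1
    field_simp
    ring
  have hp' : (p : ℂ) ≠ 0 := by exact_mod_cast hp.ne'
  rw [← hexp]
  simp only [Complex.real_smul]
  push_cast
  field_simp

theorem norm_cexp_neg_sub_one_add_le {z : ℂ} (hz : 0 ≤ z.re) :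
    ‖Complex.exp (-z) - 1 + z‖ ≤ 3 * ‖z‖ ^ 2 := by
  rcases le_total ‖z‖ 1 with h | h
  · have := Complex.norm_exp_sub_one_sub_id_le (x := -z) (by simpa using h)
    rw [norm_neg, sub_neg_eq_add] at this
    nlinarith [sq_nonneg ‖z‖]
  · have h1 : ‖Complex.exp (-z)‖ ≤ 1 := by
      rw [Complex.norm_exp]
      simpa using hz
    calc ‖Complex.exp (-z) - 1 + z‖ ≤ ‖Complex.exp (-z)‖ + ‖(1 : ℂ)‖ + ‖z‖ :=
          (norm_add_le _ _).trans (by gcongr; exact norm_sub_le _ _)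
      _ ≤ 3 * ‖z‖ ^ 2 := by
          rw [norm_one]
          nlinarith

theorem integrableOn_exp_mul_mul_exp_neg_mul_rpow {c p : ℝ} (hc : 0 < c) (hp : 1 < p) (b : ℝ) :
    IntegrableOn (fun v : ℝ => rexp (b * v) * rexp (-(c * v ^ p))) (Ioi 0) := by
  refine integrable_of_isBigO_exp_neg one_pos ?_ ?_
  · have : Continuous fun v : ℝ => v ^ p := continuous_rpow_const (by linarith)
    fun_prop
  · refine Asymptotics.IsBigO.of_bound 1 ?_
    have h := (tendsto_rpow_atTop (sub_pos.2 hp)).eventually_ge_atTop ((b + 1) / c)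
    filter_upwards [h, Filter.eventually_gt_atTop 0] with v hv hv0
    rw [← Real.exp_add, Real.norm_eq_abs, Real.norm_eq_abs, abs_of_pos (exp_pos _),
      abs_of_pos (exp_pos _), one_mul, exp_le_exp]
    have hvp : v ^ p = v ^ (p - 1) * v := by
      rw [← rpow_add_one hv0.ne']
      simp
    rw [div_le_iff₀ hc] at hv
    rw [hvp]
    nlinarith

theorem inv_Gamma_one_sub {y : ℝ} (hy : 0 < y) :
    (Real.Gamma (1 - y))⁻¹ = Real.Gamma y * Real.sin (π * y) / π := by
  have h := Real.Gamma_mul_Gamma_one_sub y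
  have hg := (Real.Gamma_pos_of_pos hy).ne'
  by_cases hs : Real.sin (π * y) = 0
  · rw [hs, div_zero] at h
    simp [(mul_eq_zero.1 h).resolve_left hg, hs]
  · rw [eq_div_iff hs] at h
    have h1 : Real.Gamma (1 - y) ≠ 0 := fun h0 => pi_ne_zero (by rw [← h, h0]; ring)
    rw [eq_div_iff pi_ne_zero, inv_mul_eq_iff_eq_mul₀ h1]
    linarith

theorem cexp_cpow_ofReal {θ l : ℝ} (h1 : -π < θ) (h2 : θ ≤ π) (a : ℝ) :
    Complex.exp (l + θ * Complex.I) ^ (a : ℂ) = Complex.exp (a * (l + θ * Complex.I)) := by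
  rw [Complex.cpow_def_of_ne_zero (Complex.exp_ne_zero _), Complex.log_exp (by simpa) (by simpa),
    mul_comm]

/-- The unit complex number `e^(iπν/(1+ν))`, whose direction is used to rotate the contour in the
integral representation of the Mainardi function. -/
noncomputable def mainardiRay (ν : ℝ) : ℂ :=
  Complex.exp (((π * ν / (1 + ν) : ℝ) : ℂ) * Complex.I)

theorem norm_mainardiRay (ν : ℝ) : ‖mainardiRay ν‖ = 1 :=
  Complex.norm_exp_ofReal_mul_I _

theorem mainardiRay_ne_zero (ν : ℝ) : mainardiRay ν ≠ 0 :=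
  Complex.exp_ne_zero _

theorem inv_mainardiRay_re (ν : ℝ) : (mainardiRay ν)⁻¹.re = (mainardiRay ν).re := by
  rw [Complex.inv_re, Complex.normSq_eq_norm_sq, norm_mainardiRay]
  simp

theorem mainardi_angle_lt {ν : ℝ} (hν0 : 0 < ν) (hν1 : ν < 1) : π * ν / (1 + ν) < π / 2 := by
  rw [div_lt_div_iff₀ (by linarith) two_pos]
  nlinarith [pi_pos]

theorem mainardiRay_re_pos {ν : ℝ} (hν0 : 0 < ν) (hν1 : ν < 1) : 0 < (mainardiRay ν).re := by
  rw [mainardiRay, Complex.exp_ofReal_mul_I_re]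
  have : 0 ≤ π * ν / (1 + ν) := by positivity
  exact cos_pos_of_mem_Ioo ⟨by linarith [pi_pos], mainardi_angle_lt hν0 hν1⟩

theorem mainardiRay_cpow {ν : ℝ} (hν0 : 0 < ν) (hν1 : ν < 1) (a : ℝ) :
    mainardiRay ν ^ (a : ℂ) = Complex.exp (((a * (π * ν / (1 + ν)) : ℝ) : ℂ) * Complex.I) := by
  have h := mainardi_angle_lt hν0 hν1
  have h0 : 0 ≤ π * ν / (1 + ν) := by positivity
  have := cexp_cpow_ofReal (θ := π * ν / (1 + ν)) (l := 0) (by linarith [pi_pos])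
    (by linarith [pi_pos]) a
  rw [Complex.ofReal_zero, zero_add] at this
  rw [mainardiRay, this, Complex.ofReal_mul, mul_assoc]

theorem one_div_mainardiRay_mul_cpow {ν : ℝ} (hν0 : 0 < ν) (hν1 : ν < 1) {x : ℝ} (hx : 0 < x)
    (a : ℝ) : (1 / (mainardiRay ν * x)) ^ (a : ℂ) =
      ((x ^ (-a) : ℝ) : ℂ) * (mainardiRay ν ^ (a : ℂ))⁻¹ := by
  have h := mainardi_angle_lt hν0 hν1
  have h0 : 0 ≤ π * ν / (1 + ν) := by positivity
  have h1 : 1 / (mainardiRay ν * x) = Complex.exp (((-Real.log x : ℝ) : ℂ) +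
      ((-(π * ν / (1 + ν)) : ℝ) : ℂ) * Complex.I) := by
    rw [Complex.exp_add, ← Complex.ofReal_exp, Real.exp_neg, Real.exp_log hx, mainardiRay,
      Complex.ofReal_neg, neg_mul, Complex.exp_neg]
    push_cast
    rw [one_div, mul_inv, mul_comm]
  rw [h1, cexp_cpow_ofReal (by linarith [pi_pos]) (by linarith [pi_pos]), mainardiRay_cpow hν0 hν1,
    ← Complex.exp_neg, rpow_def_of_pos hx, Complex.ofReal_exp, ← Complex.exp_add]
  congr 1
  push_cast
  ring

/-- Multiplying `w = e^(iπν/(1+ν))`-powers `w^b * w^(νb)` gives `e^(iπνb)`. -/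
theorem mainardiRay_cpow_mul_cpow {ν : ℝ} (hν0 : 0 < ν) (hν1 : ν < 1) (b : ℝ) :
    mainardiRay ν ^ (b : ℂ) * mainardiRay ν ^ ((ν * b : ℝ) : ℂ) =
      Complex.exp (((π * (ν * b) : ℝ) : ℂ) * Complex.I) := by
  rw [mainardiRay_cpow hν0 hν1, mainardiRay_cpow hν0 hν1, ← Complex.exp_add, ← add_mul,
    ← Complex.ofReal_add]
  have : (1 + ν) ≠ 0 := by positivity
  congr 3
  field_simp

/-- A Laplace-type integral along a rotated ray, whose imaginary part gives the Mainardi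
function. -/
noncomputable def mainardiLaplace (ν x : ℝ) : ℂ :=
  ∫ v in Ioi (0 : ℝ), Complex.exp (-((mainardiRay ν)⁻¹ * (v ^ ν⁻¹ : ℝ))) *
    Complex.exp (-(mainardiRay ν * x * v))

theorem hasSum_mainardiLaplace {ν : ℝ} (hν0 : 0 < ν) (hν1 : ν < 1) (x : ℝ) :
    HasSum (fun n : ℕ => (-(mainardiRay ν * x)) ^ n / n.factorial *
      (ν * (mainardiRay ν ^ ((ν * (n + 1) : ℝ) : ℂ) * (Real.Gamma (ν * (n + 1)) : ℂ))))
      (mainardiLaplace ν x) := by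
  have hre := mainardiRay_re_pos hν0 hν1
  have hsum (v : ℝ) : HasSum (fun n : ℕ => (|x| * v) ^ n / n.factorial *
      rexp (-((mainardiRay ν).re * v ^ ν⁻¹)))
      (rexp (|x| * v) * rexp (-((mainardiRay ν).re * v ^ ν⁻¹))) := by
    have := NormedSpace.expSeries_div_hasSum_exp (|x| * v)
    rw [← Real.exp_eq_exp_ℝ] at this
    exact this.mul_right _
  have key := hasSum_integral_of_dominated_convergence (μ := volume.restrict (Ioi (0 : ℝ)))
    (F := fun (n : ℕ) (v : ℝ) => (-(mainardiRay ν * x)) ^ n / n.factorial *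
      (((v ^ ((n + 1 : ℝ) - 1) : ℝ) : ℂ) * Complex.exp (-((mainardiRay ν)⁻¹ * (v ^ ν⁻¹ : ℝ)))))
    (f := fun v => Complex.exp (-((mainardiRay ν)⁻¹ * (v ^ ν⁻¹ : ℝ))) *
      Complex.exp (-(mainardiRay ν * x * v)))
    (bound := fun n v => (|x| * v) ^ n / n.factorial *
      rexp (-((mainardiRay ν).re * v ^ ν⁻¹))) (fun n => by fun_prop) ?_
    (Filter.Eventually.of_forall fun v => (hsum v).summable) ?_ ?_
  · rw [mainardiLaplace]
    convert! key using 2 with n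
    rw [integral_const_mul, integral_rpow_mul_cexp_neg_mul_rpow (by positivity) (by positivity)
      (by rwa [inv_mainardiRay_re])]
    rw [show ((n : ℝ) + 1) / ν⁻¹ = ν * (n + 1) by field_simp]
    simp
  · intro n
    filter_upwards [ae_restrict_mem measurableSet_Ioi] with v hv
    simp only [mem_Ioi] at hv
    rw [norm_mul, norm_mul, norm_cexp_neg_mul_ofReal, inv_mainardiRay_re, add_sub_cancel_right,
      rpow_natCast, norm_div, norm_pow, norm_neg, norm_mul, norm_mainardiRay]
    simp only [Complex.norm_real, norm_pow, Real.norm_eq_abs, abs_of_pos hv, Complex.norm_natCast]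
    apply le_of_eq
    ring
  · simp_rw [fun v => (hsum v).tsum_eq]
    exact integrableOn_exp_mul_mul_exp_neg_mul_rpow hre (by rwa [one_lt_inv₀ hν0]) _
  · refine Filter.Eventually.of_forall fun v => ?_
    have := NormedSpace.expSeries_div_hasSum_exp (-(mainardiRay ν * x * v))
    rw [← Complex.exp_eq_exp_ℂ] at this
    convert! this.mul_left (Complex.exp (-((mainardiRay ν)⁻¹ * (v ^ ν⁻¹ : ℝ)))) using 2 with n
    rw [add_sub_cancel_right, rpow_natCast, ← neg_mul, mul_pow]
    push_cast
    ring

theorem mainardi_eq_im {ν : ℝ} (hν0 : 0 < ν) (hν1 : ν < 1) (x : ℝ) :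
    mainardi ν x = (mainardiRay ν * mainardiLaplace ν x).im / (π * ν) := by
  have h := ((hasSum_mainardiLaplace hν0 hν1 x).mul_left (mainardiRay ν)).mapL Complex.imCLM
  have h := h.div_const (π * ν)
  simp only [Complex.imCLM_apply] at h
  rw [mainardi, ← h.tsum_eq]
  congr 1 with n
  have h1 := mainardiRay_cpow_mul_cpow hν0 hν1 (n + 1)
  have h2 : mainardiRay ν ^ (((n : ℝ) + 1 : ℝ) : ℂ) = mainardiRay ν ^ n * mainardiRay ν := by
    rw [← pow_succ, ← Complex.cpow_natCast]
    push_cast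
    rfl
  rw [h2] at h1
  have h3 : mainardiRay ν * ((-(mainardiRay ν * x)) ^ n / n.factorial *
      (ν * (mainardiRay ν ^ ((ν * (n + 1) : ℝ) : ℂ) * (Real.Gamma (ν * (n + 1)) : ℂ)))) =
      (((-x) ^ n / n.factorial * ν * Real.Gamma (ν * (n + 1)) : ℝ) : ℂ) *
        Complex.exp (((π * (ν * (n + 1)) : ℝ) : ℂ) * Complex.I) := by
    rw [← h1, ← mul_neg, mul_pow]
    push_cast
    ring
  have h4 := inv_Gamma_one_sub (y := ν * (n + 1)) (by positivity)
  rw [h3, Complex.im_ofReal_mul, Complex.exp_ofReal_mul_I_im, ← div_div, div_eq_mul_inv _ (Gamma _),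
    show 1 - ν - ν * n = 1 - ν * (n + 1) by ring, h4]
  have := pi_pos
  field_simp

theorem norm_mainardiLaplace_integrand (ν x v : ℝ) :
    ‖Complex.exp (-((mainardiRay ν)⁻¹ * (v ^ ν⁻¹ : ℝ))) *
      Complex.exp (-(mainardiRay ν * x * v))‖ =
      rexp (-((mainardiRay ν).re * v ^ ν⁻¹)) * rexp (-((mainardiRay ν).re * x * v)) := by
  rw [norm_mul, norm_cexp_neg_mul_ofReal, norm_cexp_neg_mul_ofReal, inv_mainardiRay_re,
    Complex.re_mul_ofReal]

theorem integrableOn_exp_neg_mainardiRay {ν : ℝ} (hν0 : 0 < ν) (hν1 : ν < 1) {s : ℝ} (hs : -1 < s) :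
    IntegrableOn (fun v : ℝ => v ^ s * rexp (-((mainardiRay ν).re * v ^ ν⁻¹))) (Ioi 0) := by
  simpa using integrableOn_rpow_mul_exp_neg_mul_rpow (s := s) (p := ν⁻¹) hs (by positivity)
    (mainardiRay_re_pos hν0 hν1)

theorem norm_mainardiLaplace_integrand_le {ν : ℝ} (hν0 : 0 < ν) (hν1 : ν < 1) {x v : ℝ}
    (hx : 0 ≤ x) (hv : 0 < v) :
    ‖Complex.exp (-((mainardiRay ν)⁻¹ * (v ^ ν⁻¹ : ℝ))) *
      Complex.exp (-(mainardiRay ν * x * v))‖ ≤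
      v ^ (0 : ℝ) * rexp (-((mainardiRay ν).re * v ^ ν⁻¹)) := by
  have hre := mainardiRay_re_pos hν0 hν1
  rw [norm_mainardiLaplace_integrand, rpow_zero, one_mul]
  refine mul_le_of_le_one_right (exp_pos _).le (exp_le_one_iff.2 ?_)
  have : 0 ≤ (mainardiRay ν).re * x * v := by positivity
  linarith

theorem continuousOn_mainardiLaplace {ν : ℝ} (hν0 : 0 < ν) (hν1 : ν < 1) :
    ContinuousOn (mainardiLaplace ν) (Ioi 0) := by
  refine continuousOn_of_dominated (fun x _ => by fun_prop) (fun x hx => ?_)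
    (integrableOn_exp_neg_mainardiRay hν0 hν1 (s := 0) (by norm_num))
    (Filter.Eventually.of_forall fun v => by fun_prop)
  filter_upwards [ae_restrict_mem measurableSet_Ioi] with v hv
  exact norm_mainardiLaplace_integrand_le hν0 hν1 (le_of_lt hx) hv

theorem norm_mainardiLaplace_le {ν : ℝ} (hν0 : 0 < ν) (hν1 : ν < 1) {x : ℝ} (hx : 0 ≤ x) :
    ‖mainardiLaplace ν x‖ ≤
      ∫ v in Ioi (0 : ℝ), v ^ (0 : ℝ) * rexp (-((mainardiRay ν).re * v ^ ν⁻¹)) := by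
  refine norm_integral_le_of_norm_le
    (integrableOn_exp_neg_mainardiRay hν0 hν1 (s := 0) (by norm_num)) ?_
  filter_upwards [ae_restrict_mem measurableSet_Ioi] with v hv
  exact norm_mainardiLaplace_integrand_le hν0 hν1 hx hv

/-- The first two terms of the expansion at infinity of `mainardiLaplace` do not contribute to the
Mainardi function. -/
theorem abs_im_mainardiRay_mul_mainardiLaplace_le {ν : ℝ} (hν0 : 0 < ν) (hν1 : ν < 1) {x : ℝ}
    (hx : 0 < x) : |(mainardiRay ν * mainardiLaplace ν x).im| ≤
      3 * ((1 / ((mainardiRay ν).re * x)) ^ (2 * ν⁻¹ + 1) * Real.Gamma (2 * ν⁻¹ + 1)) := by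
  have hre := mainardiRay_re_pos hν0 hν1
  have hz : 0 < (mainardiRay ν * x).re := by
    rw [Complex.re_mul_ofReal]
    positivity
  have hw := mainardiRay_ne_zero ν
  have hp : 0 < ν⁻¹ := by positivity
  set R : ℝ → ℂ := fun v => (Complex.exp (-((mainardiRay ν)⁻¹ * (v ^ ν⁻¹ : ℝ))) - 1 +
    (mainardiRay ν)⁻¹ * (v ^ ν⁻¹ : ℝ)) * Complex.exp (-(mainardiRay ν * x * v)) with hR
  have hbint := (integrableOn_rpow_mul_exp_neg_mul (a := 2 * ν⁻¹ + 1) (by positivity)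
    (mul_pos hre hx)).const_mul 3
  have hRle : ∀ᵐ v ∂volume.restrict (Ioi (0 : ℝ)), ‖R v‖ ≤
      3 * (v ^ (2 * ν⁻¹ + 1 - 1) * rexp (-((mainardiRay ν).re * x * v))) := by
    filter_upwards [ae_restrict_mem measurableSet_Ioi] with v hv
    simp only [mem_Ioi] at hv
    have hvp : 0 ≤ v ^ ν⁻¹ := rpow_nonneg hv.le _
    have h1 := norm_cexp_neg_sub_one_add_le (z := (mainardiRay ν)⁻¹ * (v ^ ν⁻¹ : ℝ)) (by
      rw [Complex.re_mul_ofReal, inv_mainardiRay_re]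
      positivity)
    rw [norm_mul, norm_inv, norm_mainardiRay, inv_one, one_mul, Complex.norm_real,
      Real.norm_of_nonneg hvp] at h1
    rw [hR, norm_mul, norm_cexp_neg_mul_ofReal, Complex.re_mul_ofReal, ← mul_assoc,
      add_sub_cancel_right, mul_comm 2 ν⁻¹, rpow_mul hv.le, rpow_two]
    gcongr
  have hRint : IntegrableOn R (Ioi 0) := hbint.mono' (by fun_prop) hRle
  have h0int := integrableOn_rpow_mul_cexp_neg_mul one_pos hz
  have h1int := (integrableOn_rpow_mul_cexp_neg_mul (a := ν⁻¹ + 1) (by positivity) hz).const_mul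
    (mainardiRay ν)⁻¹
  have haddint : IntegrableOn (fun v => R v + ((v ^ ((1 : ℝ) - 1) : ℝ) : ℂ) *
      Complex.exp (-(mainardiRay ν * x * v))) (Ioi 0) := hRint.add h0int
  have hpow : mainardiRay ν ^ ((ν⁻¹ + 1 : ℝ) : ℂ) = -1 := by
    have : (1 + ν) ≠ 0 := by positivity
    rw [mainardiRay_cpow hν0 hν1, show (ν⁻¹ + 1) * (π * ν / (1 + ν)) = π by field_simp,
      Complex.exp_pi_mul_I]
  have hone : mainardiRay ν ^ ((1 : ℝ) : ℂ) = mainardiRay ν := by simp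
  have hsplit : mainardiRay ν * mainardiLaplace ν x = mainardiRay ν * (∫ v in Ioi (0 : ℝ), R v) +
      ((x ^ (-1 : ℝ) + x ^ (-(ν⁻¹ + 1)) * Real.Gamma (ν⁻¹ + 1) : ℝ) : ℂ) := by
    have : mainardiLaplace ν x = (∫ v in Ioi (0 : ℝ), R v) +
        (∫ v in Ioi (0 : ℝ), ((v ^ ((1 : ℝ) - 1) : ℝ) : ℂ) *
          Complex.exp (-(mainardiRay ν * x * v))) -
        ∫ v in Ioi (0 : ℝ), (mainardiRay ν)⁻¹ * (((v ^ (ν⁻¹ + 1 - 1) : ℝ) : ℂ) *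
          Complex.exp (-(mainardiRay ν * x * v))) := by
      rw [← integral_add hRint h0int, ← integral_sub haddint h1int, mainardiLaplace]
      congr 1 with v
      simp only [hR, sub_self, rpow_zero, add_sub_cancel_right]
      push_cast
      ring
    rw [this, integral_const_mul, integral_rpow_mul_cexp_neg_mul one_pos hz,
      integral_rpow_mul_cexp_neg_mul (by positivity) hz,
      one_div_mainardiRay_mul_cpow hν0 hν1 hx, one_div_mainardiRay_mul_cpow hν0 hν1 hx, hpow, hone,
      Real.Gamma_one]
    push_cast
    field_simp
    ring
  rw [hsplit, Complex.add_im, Complex.ofReal_im, add_zero]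
  refine (Complex.abs_im_le_norm _).trans ?_
  rw [norm_mul, norm_mainardiRay, one_mul, ← integral_rpow_mul_exp_neg_mul_Ioi (by positivity)
    (mul_pos hre hx), ← integral_const_mul]
  exact norm_integral_le_of_norm_le hbint hRle

theorem integrable_mellin_mainardiLaplace {ν : ℝ} (hν0 : 0 < ν) (hν1 : ν < 1) {s : ℝ}
    (hs0 : 0 < s) (hs1 : s < 1) :
    Integrable (Function.uncurry fun x v : ℝ => ((x ^ (s - 1) : ℝ) : ℂ) *
      (Complex.exp (-((mainardiRay ν)⁻¹ * (v ^ ν⁻¹ : ℝ))) *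
        Complex.exp (-(mainardiRay ν * x * v))))
      ((volume.restrict (Ioi 0)).prod (volume.restrict (Ioi 0))) := by
  have hre := mainardiRay_re_pos hν0 hν1
  have hnorm (x v : ℝ) (hx : 0 < x) : ‖((x ^ (s - 1) : ℝ) : ℂ) *
      (Complex.exp (-((mainardiRay ν)⁻¹ * (v ^ ν⁻¹ : ℝ))) *
        Complex.exp (-(mainardiRay ν * x * v)))‖ = rexp (-((mainardiRay ν).re * v ^ ν⁻¹)) *
        (x ^ (s - 1) * rexp (-((mainardiRay ν).re * v * x))) := by
    rw [norm_mul, norm_mainardiLaplace_integrand, Complex.norm_real,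
      Real.norm_of_nonneg (rpow_nonneg hx.le _)]
    ring_nf
  have hmeas : AEStronglyMeasurable (Function.uncurry fun x v : ℝ => ((x ^ (s - 1) : ℝ) : ℂ) *
      (Complex.exp (-((mainardiRay ν)⁻¹ * (v ^ ν⁻¹ : ℝ))) *
        Complex.exp (-(mainardiRay ν * x * v))))
      ((volume.restrict (Ioi 0)).prod (volume.restrict (Ioi 0))) := by
    unfold Function.uncurry
    fun_prop
  refine (integrable_prod_iff' hmeas).2 ⟨?_, ?_⟩
  · filter_upwards [ae_restrict_mem measurableSet_Ioi] with v hv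
    simp only [mem_Ioi] at hv
    refine ((integrableOn_rpow_mul_exp_neg_mul hs0 (mul_pos hre hv)).const_mul
      (rexp (-((mainardiRay ν).re * v ^ ν⁻¹)))).mono' (by unfold Function.uncurry; fun_prop) ?_
    filter_upwards [ae_restrict_mem measurableSet_Ioi] with x hx
    exact (hnorm x v hx).le
  · refine IntegrableOn.congr_fun ((integrableOn_exp_neg_mainardiRay hν0 hν1 (s := -s)
      (by linarith)).const_mul ((1 / (mainardiRay ν).re) ^ s * Real.Gamma s)) (fun v hv => ?_)
      measurableSet_Ioi
    simp only [mem_Ioi] at hv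
    simp only [Function.uncurry]
    rw [setIntegral_congr_fun measurableSet_Ioi fun x hx => hnorm x v hx, integral_const_mul,
      integral_rpow_mul_exp_neg_mul_Ioi hs0 (mul_pos hre hv), one_div, one_div, mul_inv,
      mul_rpow (by positivity) (by positivity), inv_rpow hv.le, ← rpow_neg hv.le]
    ring

theorem integral_rpow_mul_mainardiLaplace {ν : ℝ} (hν0 : 0 < ν) (hν1 : ν < 1) {s : ℝ}
    (hs0 : 0 < s) (hs1 : s < 1) :
    ∫ x in Ioi (0 : ℝ), ((x ^ (s - 1) : ℝ) : ℂ) * mainardiLaplace ν x =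
      (mainardiRay ν ^ (s : ℂ))⁻¹ * Real.Gamma s *
        (ν * (mainardiRay ν ^ ((ν * (1 - s) : ℝ) : ℂ) * Real.Gamma (ν * (1 - s)))) := by
  have hre := mainardiRay_re_pos hν0 hν1
  simp_rw [mainardiLaplace, ← integral_const_mul]
  rw [integral_integral_swap (integrable_mellin_mainardiLaplace hν0 hν1 hs0 hs1)]
  have h := integral_rpow_mul_cexp_neg_mul_rpow (a := 1 - s) (p := ν⁻¹) (by linarith)
    (by positivity) (z := (mainardiRay ν)⁻¹) (by rwa [inv_mainardiRay_re])
  rw [show (1 - s) / ν⁻¹ = ν * (1 - s) by field_simp] at h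
  have hν : ((1 : ℂ) / ((ν⁻¹ : ℝ) : ℂ)) = ν := by simp
  rw [hν, one_div, inv_inv] at h
  rw [← h, ← integral_const_mul]
  refine setIntegral_congr_fun measurableSet_Ioi fun v hv => ?_
  simp only [mem_Ioi] at hv
  have h1 := integral_rpow_mul_cexp_neg_mul hs0 (z := mainardiRay ν * v) (by
    rw [Complex.re_mul_ofReal]
    positivity)
  rw [one_div_mainardiRay_mul_cpow hν0 hν1 hv] at h1
  rw [show 1 - s - 1 = -s by ring]
  calc _ = Complex.exp (-((mainardiRay ν)⁻¹ * (v ^ ν⁻¹ : ℝ))) * ∫ x in Ioi (0 : ℝ),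
        ((x ^ (s - 1) : ℝ) : ℂ) * Complex.exp (-(mainardiRay ν * v * x)) := by
        rw [← integral_const_mul]
        congr 1 with x
        ring_nf
    _ = _ := by
        rw [h1]
        ring

theorem integral_rpow_mul_mainardi_of_lt_one {ν : ℝ} (hν0 : 0 < ν) (hν1 : ν < 1) {s : ℝ}
    (hs0 : 0 < s) (hs1 : s < 1) :
    ∫ x in Ioi (0 : ℝ), x ^ (s - 1) * mainardi ν x =
      Real.Gamma s * (Real.Gamma (1 - ν + ν * s))⁻¹ := by
  have hint : IntegrableOn (fun x : ℝ => mainardiRay ν *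
      (((x ^ (s - 1) : ℝ) : ℂ) * mainardiLaplace ν x)) (Ioi 0) := by
    have := (integrable_mellin_mainardiLaplace hν0 hν1 hs0 hs1).integral_prod_left
    simp only [Function.uncurry, integral_const_mul] at this
    exact this.const_mul _
  have him := Complex.imCLM.integral_comp_comm hint
  rw [integral_const_mul, integral_rpow_mul_mainardiLaplace hν0 hν1 hs0 hs1] at him
  have hexp := mainardiRay_cpow_mul_cpow hν0 hν1 (1 - s)
  rw [Complex.ofReal_sub, Complex.cpow_sub _ _ (mainardiRay_ne_zero ν), Complex.ofReal_one,
    Complex.cpow_one] at hexp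
  have hval : mainardiRay ν * ((mainardiRay ν ^ (s : ℂ))⁻¹ * Real.Gamma s *
      (ν * (mainardiRay ν ^ ((ν * (1 - s) : ℝ) : ℂ) * Real.Gamma (ν * (1 - s))))) =
      ((Real.Gamma s * ν * Real.Gamma (ν * (1 - s)) : ℝ) : ℂ) *
        Complex.exp (((π * (ν * (1 - s)) : ℝ) : ℂ) * Complex.I) := by
    rw [← hexp]
    push_cast
    ring
  rw [hval, Complex.imCLM_apply, Complex.im_ofReal_mul, Complex.exp_ofReal_mul_I_im] at him
  have hM : ∫ x in Ioi (0 : ℝ), x ^ (s - 1) * mainardi ν x =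
      (∫ x in Ioi (0 : ℝ), Complex.imCLM (mainardiRay ν *
        (((x ^ (s - 1) : ℝ) : ℂ) * mainardiLaplace ν x))) / (π * ν) := by
    rw [← integral_div]
    congr 1 with x
    rw [mainardi_eq_im hν0 hν1, Complex.imCLM_apply, mul_left_comm, Complex.im_ofReal_mul]
    ring
  rw [hM, him, show 1 - ν + ν * s = 1 - ν * (1 - s) by ring,
    inv_Gamma_one_sub (mul_pos hν0 (by linarith))]
  have := pi_pos
  field_simp

/-- The Mellin transform of the Mainardi function, for exponents up to `1 + 2/ν`. -/
theorem integral_rpow_mul_mainardi {ν : ℝ} (hν0 : 0 < ν) (hν1 : ν < 1) {s : ℝ}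
    (hs0 : 0 < s) (hs1 : s < 2 * ν⁻¹ + 1) :
    ∫ x in Ioi (0 : ℝ), x ^ (s - 1) * mainardi ν x =
      Real.Gamma s * (Real.Gamma (1 - ν + ν * s))⁻¹ := by
  have hre := mainardiRay_re_pos hν0 hν1
  have hmellin (r : ℝ) : mellin (fun x => (mainardi ν x : ℂ)) r =
      ((∫ x in Ioi (0 : ℝ), x ^ (r - 1) * mainardi ν x : ℝ) : ℂ) := by
    rw [mellin, ← integral_complex_ofReal]
    refine setIntegral_congr_fun measurableSet_Ioi fun x hx => ?_
    simp only [mem_Ioi] at hx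
    simp [Complex.ofReal_cpow hx.le]
  have hcont : ContinuousOn (fun x => (mainardi ν x : ℂ)) (Ioi 0) := by
    simp_rw [mainardi_eq_im hν0 hν1]
    have := continuousOn_mainardiLaplace hν0 hν1
    fun_prop
  have htop : (fun x => (mainardi ν x : ℂ)) =O[Filter.atTop] (· ^ (-(2 * ν⁻¹ + 1)) : ℝ → ℝ) := by
    refine Asymptotics.IsBigO.of_bound (3 * ((1 / (mainardiRay ν).re) ^ (2 * ν⁻¹ + 1) *
      Real.Gamma (2 * ν⁻¹ + 1)) / (π * ν)) ?_
    filter_upwards [Filter.eventually_gt_atTop 0] with x hx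
    have h := abs_im_mainardiRay_mul_mainardiLaplace_le hν0 hν1 hx
    rw [one_div, mul_inv, mul_rpow (by positivity) (by positivity), inv_rpow hx.le,
      ← rpow_neg hx.le] at h
    rw [Complex.norm_real, Real.norm_eq_abs, mainardi_eq_im hν0 hν1, abs_div,
      abs_of_pos (mul_pos pi_pos hν0), Real.norm_of_nonneg (rpow_nonneg hx.le _), one_div,
      div_mul_eq_mul_div]
    have := pi_pos
    gcongr
    linarith
  have hbot : (fun x => (mainardi ν x : ℂ)) =O[nhdsWithin 0 (Ioi 0)] (· ^ (-(0 : ℝ)) : ℝ → ℝ) := by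
    refine Asymptotics.IsBigO.of_bound ((∫ v in Ioi (0 : ℝ), v ^ (0 : ℝ) *
      rexp (-((mainardiRay ν).re * v ^ ν⁻¹))) / (π * ν)) ?_
    filter_upwards [self_mem_nhdsWithin] with x hx
    have h := (Complex.abs_im_le_norm (mainardiRay ν * mainardiLaplace ν x))
    rw [norm_mul, norm_mainardiRay, one_mul] at h
    rw [Complex.norm_real, Real.norm_eq_abs, mainardi_eq_im hν0 hν1, abs_div,
      abs_of_pos (mul_pos pi_pos hν0), neg_zero, rpow_zero, norm_one, mul_one]
    have := pi_pos
    gcongr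
    exact h.trans (norm_mainardiLaplace_le hν0 hν1 (le_of_lt hx))
  have hGamma : DifferentiableOn ℂ (fun z : ℂ => Complex.Gamma z *
      (Complex.Gamma (1 - ν + ν * z))⁻¹) {z | 0 < z.re ∧ z.re < 2 * ν⁻¹ + 1} := by
    intro z hz
    refine DifferentiableAt.differentiableWithinAt (DifferentiableAt.mul ?_ ?_)
    · refine Complex.differentiableAt_Gamma _ fun m h => ?_
      have := hz.1
      rw [h] at this
      simp at this
      linarith [(Nat.cast_nonneg m : (0 : ℝ) ≤ m)]
    · exact (Complex.differentiable_one_div_Gamma _).comp z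
        (f := fun z : ℂ => 1 - (ν : ℂ) + ν * z) (by fun_prop)
  have hopen : IsOpen {z : ℂ | 0 < z.re ∧ z.re < 2 * ν⁻¹ + 1} :=
    (isOpen_lt continuous_const Complex.continuous_re).inter
      (isOpen_lt Complex.continuous_re continuous_const)
  have hconn : IsPreconnected {z : ℂ | 0 < z.re ∧ z.re < 2 * ν⁻¹ + 1} :=
    ((convex_halfSpace_re_gt 0).inter (convex_halfSpace_re_lt _)).isPreconnected
  have heq := eqOn_of_eventuallyEq_ofReal hopen hconn (x₀ := 1 / 2)
    (f := mellin (fun x => (mainardi ν x : ℂ)))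
    (g := fun z : ℂ => Complex.Gamma z * (Complex.Gamma (1 - ν + ν * z))⁻¹)
    (fun z hz => (mellin_differentiableAt_of_isBigO_rpow
      (hcont.locallyIntegrableOn measurableSet_Ioi) htop hz.2 hbot hz.1).differentiableWithinAt)
    hGamma ⟨by norm_num, by
      rw [Complex.ofReal_re]
      linarith [inv_pos.2 hν0]⟩ ?_
  · have := heq (x := (s : ℂ)) ⟨by simpa using hs0, by simpa using hs1⟩
    simp only [hmellin] at this
    rw [Complex.Gamma_ofReal, show (1 - ν + ν * s : ℂ) = ((1 - ν + ν * s : ℝ) : ℂ) by push_cast; rfl,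
      Complex.Gamma_ofReal] at this
    exact_mod_cast this
  · filter_upwards [eventually_gt_nhds (by norm_num : (0 : ℝ) < 1 / 2),
      eventually_lt_nhds (by norm_num : (1 / 2 : ℝ) < 1)] with r hr0 hr1
    rw [hmellin, integral_rpow_mul_mainardi_of_lt_one hν0 hν1 hr0 hr1, Complex.Gamma_ofReal,
      show (1 - ν + ν * r : ℂ) = ((1 - ν + ν * r : ℝ) : ℂ) by push_cast; rfl, Complex.Gamma_ofReal]
    push_cast
    rfl

/-- The moments of the signaling Green function. -/
theorem integral_rpow_mul_greenSignaling {ν : ℝ} (hν0 : 0 < ν) (hν1 : ν < 1) {t : ℝ} (ht : 0 < t)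
    {s : ℝ} (hs0 : 0 < s) (hs1 : s < 2 * ν⁻¹ + 1) :
    ∫ r in Ioi (0 : ℝ), ν / t ^ (ν + 1) * (r ^ (s - 1) * mainardi ν (r / t ^ ν)) =
      ν / t ^ (ν + 1) * ((t ^ ν) ^ s * (Real.Gamma s * (Real.Gamma (1 - ν + ν * s))⁻¹)) := by
  have hT : 0 < t ^ ν := rpow_pos_of_pos ht ν
  have h := integral_comp_mul_left_Ioi (fun x : ℝ => x ^ (s - 1) * mainardi ν x) 0
    (inv_pos.2 hT)
  rw [mul_zero, integral_rpow_mul_mainardi hν0 hν1 hs0 hs1, inv_inv, smul_eq_mul] at h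
  have hpow : (t ^ ν) ^ s = (t ^ ν) ^ (s - 1) * t ^ ν := by
    rw [← rpow_add_one hT.ne', sub_add_cancel]
  rw [integral_const_mul, hpow, mul_assoc ((t ^ ν) ^ (s - 1)), ← h]
  congr 1
  rw [← integral_const_mul]
  refine setIntegral_congr_fun measurableSet_Ioi fun r hr => ?_
  simp only [mem_Ioi] at hr
  have : 0 < (t ^ ν) ^ (s - 1) := rpow_pos_of_pos hT _
  simp only [inv_mul_eq_div, div_rpow hr.le hT.le]
  field_simp

theorem greenSignaling_center_of_gravity (ν : ℝ) (hν0 : 0 < ν) (hν1 : ν < 1)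
    (t : ℝ) (ht : 0 < t) :
    (∫ r in Ioi (0 : ℝ), r * greenSignaling ν r t) /
        (∫ r in Ioi (0 : ℝ), greenSignaling ν r t) =
      (Real.Gamma ν / Real.Gamma (2 * ν)) * t ^ ν ∧
    (Real.Gamma ν / Real.Gamma (2 * ν)) * t ^ ν =
      (Real.sqrt π * 2 ^ (1 - 2 * ν) / Real.Gamma (ν + 1 / 2)) * t ^ ν := by
  have hT : 0 < t ^ ν := rpow_pos_of_pos ht ν
  have hν2 : 1 < ν⁻¹ := by rwa [one_lt_inv₀ hν0]
  have h2 := integral_rpow_mul_greenSignaling hν0 hν1 ht (s := 2) (by norm_num) (by linarith)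
  have h3 := integral_rpow_mul_greenSignaling hν0 hν1 ht (s := 3) (by norm_num) (by linarith)
  have hG0 := Real.Gamma_pos_of_pos hν0
  have hG1 := Real.Gamma_pos_of_pos (s := 2 * ν) (by positivity)
  have hG2 := Real.Gamma_pos_of_pos (s := ν + 1 / 2) (by positivity)
  have hnum : ∫ r in Ioi (0 : ℝ), r * greenSignaling ν r t =
      ν / t ^ (ν + 1) * ((t ^ ν) ^ 3 * (2 * (2 * ν * Real.Gamma (2 * ν))⁻¹)) := by
    rw [show 1 - ν + ν * 3 = 2 * ν + 1 by ring, Real.Gamma_add_one (by positivity),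
      show (3 : ℝ) = ((2 : ℕ) : ℝ) + 1 by norm_num, Real.Gamma_nat_eq_factorial] at h3
    convert! h3 using 1
    · congr 1 with r
      rw [greenSignaling, add_sub_cancel_right, rpow_natCast]
      ring
    · norm_num [Nat.factorial]
  have hden : ∫ r in Ioi (0 : ℝ), greenSignaling ν r t =
      ν / t ^ (ν + 1) * ((t ^ ν) ^ 2 * (ν * Real.Gamma ν)⁻¹) := by
    rw [show 1 - ν + ν * 2 = ν + 1 by ring, Real.Gamma_add_one hν0.ne', Real.Gamma_two, one_mul,
      rpow_two] at h2
    rw [← h2]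
    congr 1 with r
    rw [greenSignaling, show (2 : ℝ) - 1 = 1 by norm_num, rpow_one]
    ring
  constructor
  · have := rpow_pos_of_pos ht (ν + 1)
    rw [hnum, hden]
    field_simp
  · congr 1
    rw [div_eq_div_iff hG1.ne' hG2.ne', Real.Gamma_mul_Gamma_add_half]
    ring
end
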